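/- Assume x = (x_1,…,x_n) is drawn from the volume sampling distribution γ_n^ν with ν = wμ and n ≥ m. Then the empirical Gram matrix G^w = G^w(x) is almost surely invertible and: (i) E((G^w)^{-1}) ⪯ (n/(n−m+1))·I in the Loewner order, with equality when the matrix Φ^w(y) has rank m almost surely for y ∼ ν^{⊗n}; and (ii) E(λ_min(G^w)^{-1}) ≤ n·m/(n−m+1). -/

import Mathlib

open MeasureTheory ProbabilityTheory Matrix Finset
open scoped ENNReal NNReal BigOperators RealInnerProductSpace

noncomputable section

namespace WLSDPP

variable {𝓧 : Type*} [MeasurableSpace 𝓧]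

/-- Smallest eigenvalue of a real symmetric matrix, via the Rayleigh quotient. -/
def lambdaMin {m : ℕ} (A : Matrix (Fin m) (Fin m) ℝ) : ℝ :=
  ⨅ v : {v : Fin m → ℝ // ∑ i, v i ^ 2 = 1}, (v : Fin m → ℝ) ⬝ᵥ A.mulVec v

/-- The feature vector `𝛗(x) = (φ₁(x),…,φ_m(x))ᵀ`. -/
def feat {m : ℕ} (φ : Fin m → 𝓧 → ℝ) (x : 𝓧) : Fin m → ℝ := fun j => φ j x

/-- Empirical Gram matrix `G^w(x) = (1/n) ∑ᵢ w(xᵢ)⁻¹ 𝛗(xᵢ)𝛗(xᵢ)ᵀ`. -/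
def gram {m n : ℕ} (φ : Fin m → 𝓧 → ℝ) (w : 𝓧 → ℝ) (x : Fin n → 𝓧) :
    Matrix (Fin m) (Fin m) ℝ :=
  (n : ℝ)⁻¹ • ∑ i, (w (x i))⁻¹ • vecMulVec (feat φ (x i)) (feat φ (x i))

/-- Empirical seminorm squared `‖f‖ₙ² = (1/n) ∑ᵢ w(xᵢ)⁻¹ f(xᵢ)²`. -/
def empSq {n : ℕ} (w : 𝓧 → ℝ) (f : 𝓧 → ℝ) (x : Fin n → 𝓧) : ℝ :=
  (n : ℝ)⁻¹ * ∑ i, (w (x i))⁻¹ * f (x i) ^ 2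

/-- Squared L²(μ) norm. -/
def l2Sq (μ : Measure 𝓧) (f : 𝓧 → ℝ) : ℝ := ∫ y, f y ^ 2 ∂μ

/-- L²(μ) norm. -/
def l2 (μ : Measure 𝓧) (f : 𝓧 → ℝ) : ℝ := Real.sqrt (l2Sq μ f)

/-- The element of `V_m` with coefficient vector `a`. -/
def lin {m : ℕ} (φ : Fin m → 𝓧 → ℝ) (a : Fin m → ℝ) : 𝓧 → ℝ := fun y => ∑ j, a j * φ j y

/-- The L²(μ)-orthogonal projection onto `V_m` (for `φ` an orthonormal basis of `V_m`). -/
def projV {m : ℕ} (μ : Measure 𝓧) (φ : Fin m → 𝓧 → ℝ) (f : 𝓧 → ℝ) : 𝓧 → ℝ :=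
  lin φ (fun j => ∫ y, φ j y * f y ∂μ)

/-- The right-hand side vector `b = (1/n) ∑ᵢ w(xᵢ)⁻¹ f(xᵢ) 𝛗(xᵢ)`. -/
def bVec {m n : ℕ} (φ : Fin m → 𝓧 → ℝ) (w : 𝓧 → ℝ) (f : 𝓧 → ℝ) (x : Fin n → 𝓧) :
    Fin m → ℝ :=
  (n : ℝ)⁻¹ • ∑ i, ((w (x i))⁻¹ * f (x i)) • feat φ (x i)

/-- The weighted least-squares projection `P̂_{V_m} f = 𝛗(·)ᵀ (G^w)⁻¹ b`. -/
def lsProj {m n : ℕ} (φ : Fin m → 𝓧 → ℝ) (w : 𝓧 → ℝ) (f : 𝓧 → ℝ) (x : Fin n → 𝓧) :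
    𝓧 → ℝ :=
  lin φ ((gram φ w x)⁻¹ *ᵥ bVec φ w f x)

/-- The measure with density `w` with respect to `μ`. -/
def dens (μ : Measure 𝓧) (w : 𝓧 → ℝ) : Measure 𝓧 :=
  μ.withDensity fun a => ENNReal.ofReal (w a)

/-- The inverse Christoffel density `w_m(x) = (1/m) ‖𝛗(x)‖₂²`. -/
def wChr {m : ℕ} (φ : Fin m → 𝓧 → ℝ) : 𝓧 → ℝ := fun x => (m : ℝ)⁻¹ * ∑ i, φ i x ^ 2

/-- The feature matrix `Φ(x)` with `i`-th row `𝛗(xᵢ)ᵀ`. -/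
def featM {m n : ℕ} (φ : Fin m → 𝓧 → ℝ) (x : Fin n → 𝓧) : Matrix (Fin n) (Fin m) ℝ :=
  Matrix.of fun i j => φ j (x i)

/-- The weighted feature matrix `Φ^w(x)` with `i`-th row `w(xᵢ)^{-1/2} 𝛗(xᵢ)ᵀ`. -/
def featW {m n : ℕ} (φ : Fin m → 𝓧 → ℝ) (w : 𝓧 → ℝ) (x : Fin n → 𝓧) :
    Matrix (Fin n) (Fin m) ℝ :=
  Matrix.of fun i j => (Real.sqrt (w (x i)))⁻¹ * φ j (x i)

/-- The projection DPP `γ_m`, with density `(1/m!) det(Φ(x)ᵀΦ(x))` w.r.t. `μ^⊗m`. -/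
def dpp {m : ℕ} (μ : Measure 𝓧) (φ : Fin m → 𝓧 → ℝ) : Measure (Fin m → 𝓧) :=
  (Measure.pi fun _ : Fin m => μ).withDensity fun x =>
    ENNReal.ofReal ((m.factorial : ℝ)⁻¹ * ((featM φ x)ᵀ * featM φ x).det)

/-- The generalized volume sampling distribution `γ_n^ν`, `ν = wμ`, with density
`n^m ((n−m)!/n!) det(G^w(x))` with respect to `ν^⊗n`. -/
def vs {m : ℕ} (μ : Measure 𝓧) (φ : Fin m → 𝓧 → ℝ) (w : 𝓧 → ℝ) (n : ℕ) :
    Measure (Fin n → 𝓧) :=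
  (Measure.pi fun _ : Fin n => dens μ w).withDensity fun x =>
    ENNReal.ofReal ((n : ℝ) ^ m * ((n - m).factorial : ℝ) / (n.factorial : ℝ) *
      (gram φ w x).det)

/-- `c_δ = δ + (1−δ) log(1−δ)`. -/
def cDelta (δ : ℝ) : ℝ := δ + (1 - δ) * Real.log (1 - δ)

/-- `φ₁, …, φ_m` is an orthonormal system in `L²_μ`. -/
def IsONB {m : ℕ} (μ : Measure 𝓧) (φ : Fin m → 𝓧 → ℝ) : Prop :=
  ∀ i j, ∫ y, φ i y * φ j y ∂μ = if i = j then (1 : ℝ) else 0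

end WLSDPP

namespace Matrix

lemma PosSemidef.adjugate {m : Type*} [Fintype m] [DecidableEq m] {A : Matrix m m ℝ}
    (hA : A.PosSemidef) : A.adjugate.PosSemidef := by
  refine .of_dotProduct_mulVec_nonneg ?_ fun v => ?_
  · rw [IsHermitian, adjugate_conjTranspose, hA.isHermitian.eq]
  · have hcont : Continuous fun ε : ℝ =>
        star v ⬝ᵥ ((A + ε • (1 : Matrix m m ℝ)).adjugate *ᵥ v) :=
      continuous_const.dotProduct (Continuous.matrix_mulVec
        (Continuous.matrix_adjugate (by fun_prop)) continuous_const)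
    have hlim := (hcont.tendsto 0).mono_left (nhdsWithin_le_nhds (s := Set.Ioi 0))
    rw [zero_smul, add_zero] at hlim
    refine ge_of_tendsto hlim ?_
    filter_upwards [self_mem_nhdsWithin] with ε hε
    have hpos : (A + ε • (1 : Matrix m m ℝ)).PosDef := PosDef.posSemidef_add hA (PosDef.one.smul hε)
    have hadj : (A + ε • (1 : Matrix m m ℝ)).adjugate =
        (A + ε • (1 : Matrix m m ℝ)).det • (A + ε • (1 : Matrix m m ℝ))⁻¹ := by
      rw [inv_def, smul_smul, Ring.inverse_eq_inv', mul_inv_cancel₀ hpos.det_pos.ne', one_smul]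
    rw [hadj]
    exact (hpos.posSemidef.inv.smul hpos.det_pos.le).dotProduct_mulVec_nonneg v

/-- On unit vectors the quadratic form of a positive semidefinite matrix is at most its trace. -/
lemma PosSemidef.dotProduct_mulVec_le_trace {m : Type*} [Fintype m] [DecidableEq m]
    {M : Matrix m m ℝ} (hM : M.PosSemidef) {v : m → ℝ} (hv : v ⬝ᵥ v = 1) :
    v ⬝ᵥ (M *ᵥ v) ≤ M.trace := by
  set P : Matrix m m ℝ := 1 - vecMulVec v v with hP
  have hPH : Pᴴ = P := by ext i j; simp [hP, vecMulVec_apply, one_apply, eq_comm, mul_comm]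
  have hPP : P * P = P := by
    have : vecMulVec v v * vecMulVec v v = vecMulVec v v := by
      rw [vecMulVec_mul_vecMulVec, hv, one_smul]
    rw [hP, sub_mul, mul_sub, mul_sub, this]; simp
  have h := (hM.conjTranspose_mul_mul_same P).trace_nonneg
  rw [hPH, trace_mul_comm, ← Matrix.mul_assoc, hPP, hP, sub_mul, trace_sub, one_mul,
    vecMulVec_mul, trace_vecMulVec, dotProduct_comm, ← dotProduct_mulVec] at h
  linarith

lemma det_ne_zero_of_rank_eq {m : Type*} [Fintype m] [DecidableEq m] {A : Matrix m m ℝ}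
    (hA : A.rank = Fintype.card m) : A.det ≠ 0 := by
  rw [← isUnit_iff_ne_zero, ← isUnit_iff_isUnit_det, ← linearIndependent_rows_iff_isUnit,
    linearIndependent_iff_card_eq_finrank_span, ← hA, rank_eq_finrank_span_row]
  rfl

/-- A determinant of sums of rank one matrices only sees injective choices of the summands. -/
lemma det_sum_mul {ι κ R : Type*} [Fintype ι] [DecidableEq ι] [Fintype κ] [CommRing R]
    (u v : ι → κ → R) :
    (of fun p q => ∑ t, u p t * v q t).det =
      ∑ f : ι ↪ κ, (of fun p q => u p (f p) * v q (f p)).det := by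
  classical
  have hexp : (of fun p q => ∑ t, u p t * v q t).det =
      ∑ f : ι → κ, (of fun p q => u p (f p) * v q (f p)).det := by
    have h := (detRowAlternating (n := ι) (R := R)).toMultilinearMap.map_sum
      (fun p (t : κ) => (fun q => u p t * v q t : ι → R))
    rw [show (of fun p q => ∑ t, u p t * v q t) =
      fun p => ∑ t : κ, (fun q => u p t * v q t : ι → R) by ext p q; simp]
    exact h
  have hzero (f : ι → κ) (hf : ¬ Function.Injective f) :
      (of fun p q => u p (f p) * v q (f p)).det = 0 := by
    simp only [Function.Injective, not_forall] at hf
    obtain ⟨a, b, hab, hne⟩ := hf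
    have h := det_mul_column (fun p => u p (f p)) (of fun p q => v q (f p))
    simp only [of_apply] at h
    rw [h, det_zero_of_row_eq hne, mul_zero]
    ext q
    simp [hab]
  rw [hexp, ← Finset.sum_filter_of_ne (p := Function.Injective)
    (fun f _ hf => by_contra fun hinj => hf (hzero f hinj)),
    ← Finset.sum_subtype_eq_sum_filter, Finset.subtype_univ]
  exact Fintype.sum_equiv (Equiv.subtypeInjectiveEquivEmbedding ι κ) _ _ fun _ => rfl

end Matrix

namespace WLSDPP

section Determinant

variable {𝓧 : Type*} [MeasurableSpace 𝓧] {ν : Measure 𝓧} [IsProbabilityMeasure ν]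
  {ι κ : Type*} [Fintype ι] [Fintype κ]

omit [MeasurableSpace 𝓧] in
lemma prod_comp_embedding (f : ι ↪ κ) (g : ι → 𝓧 → ℝ) (x : κ → 𝓧) :
    ∏ p, g p (x (f p)) = ∏ t, Function.extend f g 1 t (x t) := by
  refine Fintype.prod_of_injective f f.injective _ _ (fun t ht => ?_) fun p => ?_
  · rw [Function.extend_apply' _ _ _ (by simpa using ht)]; rfl
  · rw [f.injective.extend_apply]

lemma integrable_prod_comp_embedding (f : ι ↪ κ) {g : ι → 𝓧 → ℝ}
    (hg : ∀ p, Integrable (g p) ν) :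
    Integrable (fun x : κ → 𝓧 => ∏ p, g p (x (f p))) (Measure.pi fun _ => ν) := by
  simp_rw [prod_comp_embedding]
  refine Integrable.fintype_prod fun t => ?_
  by_cases ht : ∃ p, f p = t
  · obtain ⟨p, rfl⟩ := ht
    rw [f.injective.extend_apply]; exact hg p
  · rw [Function.extend_apply' _ _ _ ht]; exact integrable_const 1

lemma integral_prod_comp_embedding (f : ι ↪ κ) (g : ι → 𝓧 → ℝ) :
    ∫ x : κ → 𝓧, ∏ p, g p (x (f p)) ∂(Measure.pi fun _ => ν) = ∏ p, ∫ y, g p y ∂ν := by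
  simp_rw [prod_comp_embedding]
  rw [integral_fintype_prod_eq_prod]
  symm
  refine Fintype.prod_of_injective f f.injective _ _ (fun t ht => ?_) fun p => ?_
  · rw [Function.extend_apply' _ _ _ (by simpa using ht)]; simp
  · rw [f.injective.extend_apply]

variable [DecidableEq ι] {u v : ι → 𝓧 → ℝ}

omit [MeasurableSpace 𝓧] in
lemma det_sum_eq_sum_prod (u v : ι → 𝓧 → ℝ) (x : κ → 𝓧) :
    (of fun p q => ∑ t, u p (x t) * v q (x t)).det = ∑ f : ι ↪ κ, ∑ σ : Equiv.Perm ι,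
      (σ.sign : ℝ) * ∏ p, (fun y => u p y * v (σ p) y) (x (f p)) := by
  rw [det_sum_mul (fun p t => u p (x t)) (fun q t => v q (x t))]
  refine Finset.sum_congr rfl fun f _ => ?_
  rw [← det_transpose, det_apply']
  simp [Matrix.transpose_apply]

lemma integrable_det_sum (huv : ∀ p q, Integrable (fun y => u p y * v q y) ν) :
    Integrable (fun x : κ → 𝓧 => (of fun p q => ∑ t, u p (x t) * v q (x t)).det)
      (Measure.pi fun _ => ν) := by
  simp_rw [det_sum_eq_sum_prod]
  exact integrable_finsetSum _ fun f _ => integrable_finsetSum _ fun σ _ =>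
    (integrable_prod_comp_embedding f fun p => huv p (σ p)).const_mul _

/-- The expected determinant of a sum of independent rank one matrices. -/
lemma integral_det_sum (huv : ∀ p q, Integrable (fun y => u p y * v q y) ν) :
    ∫ x : κ → 𝓧, (of fun p q => ∑ t, u p (x t) * v q (x t)).det ∂(Measure.pi fun _ => ν) =
      (Fintype.card κ).descFactorial (Fintype.card ι) *
        (of fun p q => ∫ y, u p y * v q y ∂ν).det := by
  have hint (f : ι ↪ κ) (σ : Equiv.Perm ι) : Integrable (fun x : κ → 𝓧 =>
      (σ.sign : ℝ) * ∏ p, (fun y => u p y * v (σ p) y) (x (f p))) (Measure.pi fun _ => ν) :=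
    (integrable_prod_comp_embedding f fun p => huv p (σ p)).const_mul _
  simp_rw [det_sum_eq_sum_prod]
  rw [integral_finsetSum _ fun f _ => integrable_finsetSum _ fun σ _ => hint f σ]
  have hterm (f : ι ↪ κ) : ∫ x : κ → 𝓧, ∑ σ : Equiv.Perm ι,
      (σ.sign : ℝ) * ∏ p, (fun y => u p y * v (σ p) y) (x (f p)) ∂(Measure.pi fun _ => ν) =
      (of fun p q => ∫ y, u p y * v q y ∂ν).det := by
    rw [integral_finsetSum _ fun σ _ => hint f σ, ← det_transpose, det_apply']
    refine Finset.sum_congr rfl fun σ _ => ?_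
    rw [integral_const_mul, integral_prod_comp_embedding f fun p y => u p y * v (σ p) y]
    simp [Matrix.transpose_apply]
  classical
  simp_rw [hterm]
  rw [Finset.sum_const, Finset.card_univ, Fintype.card_embedding_eq, nsmul_eq_mul]

end Determinant

end WLSDPP

namespace WLSDPP

section VolumeSampling

variable {𝓧 : Type*} {m n : ℕ}

lemma lambdaMin_inv_le_trace_inv {A : Matrix (Fin m) (Fin m) ℝ} (hm : 0 < m)
    (hA : A.PosSemidef) (hdet : A.det ≠ 0) : (lambdaMin A)⁻¹ ≤ A⁻¹.trace := by
  have hunit : IsUnit A.det := hdet.isUnit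
  have key (v : Fin m → ℝ) (hv : ∑ i, v i ^ 2 = 1) :
      0 < A⁻¹.trace ∧ (A⁻¹.trace)⁻¹ ≤ v ⬝ᵥ A.mulVec v := by
    have hvv : v ⬝ᵥ v = 1 := by simpa [dotProduct, sq] using hv
    have hq := hA.inv.dotProduct_mulVec_le_trace hvv
    have hsymm : (A⁻¹)ᵀ = A⁻¹ := by simpa using hA.inv.isHermitian.eq
    have hquad (s : ℝ) : 0 ≤ v ⬝ᵥ A.mulVec v - 2 * s + s ^ 2 * (v ⬝ᵥ (A⁻¹ *ᵥ v)) := by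
      have h := hA.dotProduct_mulVec_nonneg (v - s • (A⁻¹ *ᵥ v))
      have h1 : A *ᵥ (v - s • (A⁻¹ *ᵥ v)) = A *ᵥ v - s • v := by
        rw [mulVec_sub, mulVec_smul, mulVec_mulVec, mul_nonsing_inv _ hunit, one_mulVec]
      have h2 : (A⁻¹ *ᵥ v) ⬝ᵥ (A *ᵥ v) = 1 := by
        rw [dotProduct_mulVec, ← mulVec_transpose,
          show Aᵀ = A by simpa using hA.isHermitian.eq, mulVec_mulVec,
          mul_nonsing_inv _ hunit, one_mulVec, hvv]
      rw [h1, star_trivial, sub_dotProduct, dotProduct_sub, dotProduct_sub, smul_dotProduct,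
        smul_dotProduct, dotProduct_smul, dotProduct_smul, h2, hvv,
        dotProduct_comm (A⁻¹ *ᵥ v) v] at h
      simp only [smul_eq_mul] at h
      linarith
    have hpos : 0 < A⁻¹.trace := by
      refine lt_of_le_of_ne hA.inv.trace_nonneg fun h0 => ?_
      have hbound := hA.dotProduct_mulVec_le_trace hvv
      have h := hquad (A.trace + 1)
      nlinarith [sq_nonneg (A.trace + 1), hA.trace_nonneg,
        mul_nonneg (sq_nonneg (A.trace + 1)) (sub_nonneg.2 hq)]
    refine ⟨hpos, ?_⟩
    have h := hquad (A⁻¹.trace)⁻¹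
    have h3 : (A⁻¹.trace)⁻¹ ^ 2 * (v ⬝ᵥ (A⁻¹ *ᵥ v)) ≤ (A⁻¹.trace)⁻¹ := by
      calc _ ≤ (A⁻¹.trace)⁻¹ ^ 2 * A⁻¹.trace := by gcongr
        _ = _ := by field_simp
    linarith
  have hne : ∑ i, (Pi.single (⟨0, hm⟩ : Fin m) (1 : ℝ) : Fin m → ℝ) i ^ 2 = 1 := by
    simp [Pi.single_apply]
  have : Nonempty {v : Fin m → ℝ // ∑ i, v i ^ 2 = 1} := ⟨⟨_, hne⟩⟩
  have hpos := (key _ hne).1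
  have hle : (A⁻¹.trace)⁻¹ ≤ lambdaMin A := le_ciInf fun v => (key v v.2).2
  exact inv_le_of_inv_le₀ hpos hle

lemma lambdaMin_nonneg {A : Matrix (Fin m) (Fin m) ℝ} (hA : A.PosSemidef) : 0 ≤ lambdaMin A :=
  Real.iInf_nonneg fun v => by simpa using hA.dotProduct_mulVec_nonneg v

lemma gram_apply (φ : Fin m → 𝓧 → ℝ) (w : 𝓧 → ℝ) (x : Fin n → 𝓧) (i j : Fin m) :
    gram φ w x i j = (n : ℝ)⁻¹ * ∑ t, ((w (x t))⁻¹ * φ i (x t)) * φ j (x t) := by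
  simp [gram, Matrix.sum_apply, vecMulVec_apply, feat, mul_assoc]

lemma gram_posSemidef (φ : Fin m → 𝓧 → ℝ) {w : 𝓧 → ℝ} (hw : ∀ x, 0 < w x) (x : Fin n → 𝓧) :
    (gram φ w x).PosSemidef :=
  .smul (posSemidef_sum _ fun t _ =>
    .smul (posSemidef_vecMulVec_self_star (feat φ (x t))) (inv_nonneg.2 (hw _).le)) (by positivity)

lemma gram_eq_featW (φ : Fin m → 𝓧 → ℝ) {w : 𝓧 → ℝ} (hw : ∀ x, 0 < w x) (x : Fin n → 𝓧) :
    gram φ w x = (n : ℝ)⁻¹ • ((featW φ w x)ᵀ * featW φ w x) := by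
  ext i j
  rw [gram_apply, Matrix.smul_apply, mul_apply, smul_eq_mul]
  congr 1
  refine Finset.sum_congr rfl fun t _ => ?_
  have h : (Real.sqrt (w (x t)))⁻¹ * (Real.sqrt (w (x t)))⁻¹ = (w (x t))⁻¹ := by
    rw [← mul_inv, Real.mul_self_sqrt (hw _).le]
  simp only [featW, transpose_apply, of_apply, ← h]
  ring

lemma det_gram_ne_zero_of_rank (φ : Fin m → 𝓧 → ℝ) {w : 𝓧 → ℝ} (hw : ∀ x, 0 < w x)
    (hn : n ≠ 0) {x : Fin n → 𝓧} (hrank : (featW φ w x).rank = m) : (gram φ w x).det ≠ 0 := by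
  rw [gram_eq_featW φ hw, det_smul]
  refine mul_ne_zero (by positivity) (det_ne_zero_of_rank_eq ?_)
  rw [rank_transpose_mul_self, hrank, Fintype.card_fin]

variable [MeasurableSpace 𝓧]

lemma measurable_gram {φ : Fin m → 𝓧 → ℝ} {w : 𝓧 → ℝ} (hφ : ∀ j, Measurable (φ j))
    (hw : Measurable w) (i j : Fin m) :
    Measurable fun x : Fin n → 𝓧 => gram φ w x i j := by
  simp_rw [gram_apply]
  fun_prop

lemma measurable_det_gram {φ : Fin m → 𝓧 → ℝ} {w : 𝓧 → ℝ} (hφ : ∀ j, Measurable (φ j))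
    (hw : Measurable w) : Measurable fun x : Fin n → 𝓧 => (gram φ w x).det := by
  simp_rw [det_apply']
  exact Finset.measurable_fun_sum _ fun σ _ => .const_mul
    (Finset.measurable_fun_prod _ fun i _ => measurable_gram hφ hw (σ i) i) _

omit [MeasurableSpace 𝓧] in
lemma adjugate_gram_apply {k : ℕ} (φ : Fin (k + 1) → 𝓧 → ℝ) (w : 𝓧 → ℝ) (x : Fin n → 𝓧)
    (i j : Fin (k + 1)) :
    (gram φ w x).adjugate i j = (n : ℝ)⁻¹ ^ k * (-1) ^ (j + i : ℕ) * (of fun p q => ∑ t,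
      (fun p y => (w y)⁻¹ * φ (j.succAbove p) y) p (x t) *
        (fun q => φ (i.succAbove q)) q (x t)).det := by
  rw [adjugate_fin_succ_eq_det_submatrix]
  have : (gram φ w x).submatrix j.succAbove i.succAbove = (n : ℝ)⁻¹ • of fun p q => ∑ t,
      (fun p y => (w y)⁻¹ * φ (j.succAbove p) y) p (x t) *
        (fun q => φ (i.succAbove q)) q (x t) := by
    ext p q
    simp [gram_apply]
  rw [this, det_smul, Fintype.card_fin]
  ring

section Moments

variable {ν : Measure 𝓧} [IsProbabilityMeasure ν] {φ : Fin m → 𝓧 → ℝ} {w : 𝓧 → ℝ}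

lemma integrable_adjugate_gram (hm : 0 < m)
    (hint : ∀ p q, Integrable (fun y => (w y)⁻¹ * φ p y * φ q y) ν) (i j : Fin m) :
    Integrable (fun x : Fin n → 𝓧 => (gram φ w x).adjugate i j) (Measure.pi fun _ => ν) := by
  obtain ⟨k, rfl⟩ := Nat.exists_eq_add_one.2 hm
  simp_rw [adjugate_gram_apply]
  exact (integrable_det_sum fun p q => hint _ _).const_mul _

lemma integral_adjugate_gram (hm : 0 < m)
    (hint : ∀ p q, Integrable (fun y => (w y)⁻¹ * φ p y * φ q y) ν)
    (horth : ∀ p q, ∫ y, (w y)⁻¹ * φ p y * φ q y ∂ν = if p = q then 1 else 0) (i j : Fin m) :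
    ∫ x : Fin n → 𝓧, (gram φ w x).adjugate i j ∂(Measure.pi fun _ => ν) =
      (n : ℝ)⁻¹ ^ (m - 1) * n.descFactorial (m - 1) * (1 : Matrix (Fin m) (Fin m) ℝ) i j := by
  obtain ⟨k, rfl⟩ := Nat.exists_eq_add_one.2 hm
  simp_rw [adjugate_gram_apply]
  rw [integral_const_mul, integral_det_sum fun p q => hint _ _]
  simp only [horth]
  have h := adjugate_fin_succ_eq_det_submatrix (1 : Matrix (Fin (k + 1)) (Fin (k + 1)) ℝ) i j
  rw [adjugate_one] at h
  rw [h, Fintype.card_fin, Fintype.card_fin, Nat.add_sub_cancel]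
  have h2 : (of fun p q => if j.succAbove p = i.succAbove q then (1 : ℝ) else 0) =
      (1 : Matrix (Fin (k + 1)) (Fin (k + 1)) ℝ).submatrix j.succAbove i.succAbove := by
    ext p q
    simp [one_apply]
  rw [h2]
  ring

end Moments

lemma volumeSampling_const_mul (hm : 0 < m) (hmn : m ≤ n) :
    (n : ℝ) ^ m * ((n - m).factorial : ℝ) / (n.factorial : ℝ) *
      ((n : ℝ)⁻¹ ^ (m - 1) * n.descFactorial (m - 1)) = (n : ℝ) / ((n : ℝ) - m + 1) := by
  obtain ⟨k, rfl⟩ := Nat.exists_eq_add_one.2 hm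
  obtain ⟨l, rfl⟩ := Nat.exists_eq_add_of_le hmn
  have hfac := Nat.factorial_mul_descFactorial (n := k + 1 + l) (k := k) (by omega)
  rw [show k + 1 + l - k = l + 1 by omega, Nat.factorial_succ] at hfac
  rw [← hfac, show k + 1 + l - (k + 1) = l by omega, Nat.add_sub_cancel]
  have hn : ((k + 1 + l : ℕ) : ℝ) ≠ 0 := by positivity
  have hd : ((k + 1 + l).descFactorial k : ℝ) ≠ 0 :=
    Nat.cast_ne_zero.2 (Nat.descFactorial_pos.2 (by omega)).ne'
  have hl : (l.factorial : ℝ) ≠ 0 := by positivity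
  have hk : ((k + 1 + l : ℕ) : ℝ) - (k + 1 : ℕ) + 1 = l + 1 := by push_cast; ring
  have hl1 : (l + 1 : ℝ) ≠ 0 := by positivity
  rw [hk]
  generalize ((k + 1 + l : ℕ) : ℝ) = N at *
  push_cast
  rw [pow_succ, inv_pow]
  field_simp

lemma posSemidef_integral {Ω : Type*} [MeasurableSpace Ω] {P : Measure Ω}
    {M : Ω → Matrix (Fin m) (Fin m) ℝ} (hM : ∀ x, (M x).PosSemidef)
    (hint : ∀ i j, Integrable (fun x => M x i j) P) :
    (of fun i j => ∫ x, M x i j ∂P).PosSemidef := by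
  refine .of_dotProduct_mulVec_nonneg ?_ fun v => ?_
  · ext i j
    simp only [conjTranspose_apply, of_apply, star_trivial]
    congr with x
    simpa using (hM x).isHermitian.apply i j
  · have h : star v ⬝ᵥ ((of fun i j => ∫ x, M x i j ∂P) *ᵥ v) =
        ∫ x, star v ⬝ᵥ (M x *ᵥ v) ∂P := by
      simp only [dotProduct, mulVec, of_apply]
      rw [integral_finsetSum _ fun i _ => .const_mul
        (integrable_finsetSum _ fun j _ => (hint i j).mul_const _) _]
      refine Finset.sum_congr rfl fun i _ => ?_
      rw [integral_const_mul, integral_finsetSum _ fun j _ => (hint i j).mul_const _]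
      simp_rw [integral_mul_const]
    rw [h]
    exact integral_nonneg fun x => (hM x).dotProduct_mulVec_nonneg v

section Weighted

variable {μ : Measure 𝓧} {w : 𝓧 → ℝ}

lemma isProbabilityMeasure_dens (hwpos : ∀ x, 0 < w x) (hwint : ∫ y, w y ∂μ = 1) :
    IsProbabilityMeasure (dens μ w) := by
  constructor
  rw [dens, withDensity_apply _ .univ, Measure.restrict_univ,
    ← ofReal_integral_eq_lintegral_ofReal (integrable_of_integral_eq_one hwint)
      (ae_of_all _ fun x => (hwpos x).le), hwint, ENNReal.ofReal_one]

lemma IsONB.integrable_mul {φ : Fin m → 𝓧 → ℝ} (hφ : ∀ j, Measurable (φ j)) (horth : IsONB μ φ)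
    (p q : Fin m) : Integrable (fun y => φ p y * φ q y) μ := by
  have hL (j : Fin m) : MemLp (φ j) 2 μ := by
    rw [memLp_two_iff_integrable_sq (hφ j).aestronglyMeasurable]
    refine integrable_of_integral_eq_one ?_
    simpa [sq] using horth j j
  exact (hL p).integrable_mul (hL q)

lemma integrable_dens_iff (hwpos : ∀ x, 0 < w x) (hw : Measurable w) {f : 𝓧 → ℝ} :
    Integrable f (dens μ w) ↔ Integrable (fun y => w y * f y) μ := by
  rw [dens, integrable_withDensity_iff_integrable_smul' hw.ennreal_ofReal
    (ae_of_all _ fun _ => ENNReal.ofReal_lt_top)]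
  simp [ENNReal.toReal_ofReal (hwpos _).le]

lemma integral_dens (hwpos : ∀ x, 0 < w x) (hw : Measurable w) (f : 𝓧 → ℝ) :
    ∫ y, f y ∂(dens μ w) = ∫ y, w y * f y ∂μ := by
  rw [dens, integral_withDensity_eq_integral_toReal_smul hw.ennreal_ofReal
    (ae_of_all _ fun _ => ENNReal.ofReal_lt_top)]
  simp [ENNReal.toReal_ofReal (hwpos _).le]

end Weighted

lemma det_mul_inv_apply (A : Matrix (Fin m) (Fin m) ℝ) (i j : Fin m) :
    A.det * A⁻¹ i j = if A.det = 0 then 0 else A.adjugate i j := by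
  split_ifs with h
  · rw [h, zero_mul]
  · rw [Matrix.inv_def, Matrix.smul_apply, smul_eq_mul, Ring.inverse_eq_inv', mul_inv_cancel_left₀ h]

end VolumeSampling

end WLSDPP

open WLSDPP in
/-- under volume sampling `γ_n^ν`, the Gram matrix `G^w` is a.s. invertible,
`E((G^w)⁻¹) ⪯ (n/(n−m+1)) I` (with equality when `Φ^w(y)` has rank `m` a.s. for
`y ∼ ν^⊗n`), and `E(λ_min(G^w)⁻¹) ≤ nm/(n−m+1)`. -/
theorem statement10 {𝓧 : Type*} [MeasurableSpace 𝓧] {m n : ℕ} (hm : 0 < m) (hmn : m ≤ n)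
    (μ : Measure 𝓧) [IsProbabilityMeasure μ]
    (φ : Fin m → 𝓧 → ℝ) (hφ : ∀ j, Measurable (φ j)) (horth : IsONB μ φ)
    (w : 𝓧 → ℝ) (hwpos : ∀ x, 0 < w x) (hw : Measurable w) (hwint : ∫ y, w y ∂μ = 1) :
    (∀ᵐ x ∂(vs μ φ w n), IsUnit (gram φ w x).det) ∧
    (((n : ℝ) / ((n : ℝ) - m + 1)) • (1 : Matrix (Fin m) (Fin m) ℝ) -
        Matrix.of (fun i j => ∫ x, (gram φ w x)⁻¹ i j ∂(vs μ φ w n))).PosSemidef ∧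
    ((∀ᵐ y ∂(Measure.pi fun _ : Fin n => dens μ w), (featW φ w y).rank = m) →
      Matrix.of (fun i j => ∫ x, (gram φ w x)⁻¹ i j ∂(vs μ φ w n)) =
        ((n : ℝ) / ((n : ℝ) - m + 1)) • (1 : Matrix (Fin m) (Fin m) ℝ)) ∧
    (∫ x, (lambdaMin (gram φ w x))⁻¹ ∂(vs μ φ w n) ≤ (n : ℝ) * m / ((n : ℝ) - m + 1)) := by
  have hn : n ≠ 0 := by omega
  have := isProbabilityMeasure_dens hwpos hwint
  have hcancel (p q : Fin m) (y : 𝓧) : w y * ((w y)⁻¹ * φ p y * φ q y) = φ p y * φ q y := by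
    rw [mul_assoc, mul_inv_cancel_left₀ (hwpos y).ne']
  have hint (p q : Fin m) : Integrable (fun y => (w y)⁻¹ * φ p y * φ q y) (dens μ w) := by
    rw [integrable_dens_iff hwpos hw]
    simpa only [hcancel] using horth.integrable_mul hφ p q
  have hmom (p q : Fin m) :
      ∫ y, (w y)⁻¹ * φ p y * φ q y ∂(dens μ w) = if p = q then 1 else 0 := by
    rw [integral_dens hwpos hw]
    simpa only [hcancel] using horth p q
  set P : Measure (Fin n → 𝓧) := Measure.pi fun _ => dens μ w
  set c : ℝ := (n : ℝ) ^ m * ((n - m).factorial : ℝ) / (n.factorial : ℝ)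
  set κ : ℝ := (n : ℝ) / ((n : ℝ) - m + 1) with hκ
  have hc0 : 0 ≤ c := by positivity
  have hpsd (x : Fin n → 𝓧) : (gram φ w x).PosSemidef := gram_posSemidef φ hwpos x
  have hdens : Measurable fun x : Fin n → 𝓧 => ENNReal.ofReal (c * (gram φ w x).det) :=
    ((measurable_det_gram hφ hw).const_mul c).ennreal_ofReal
  have hdens_top : ∀ᵐ x ∂P, ENNReal.ofReal (c * (gram φ w x).det) < ⊤ :=
    ae_of_all _ fun _ => ENNReal.ofReal_lt_top
  have hinv : ∀ᵐ x ∂(vs μ φ w n), IsUnit (gram φ w x).det := by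
    rw [vs, ae_withDensity_iff hdens]
    refine ae_of_all _ fun x hx => isUnit_iff_ne_zero.2 fun h0 => hx ?_
    simp [h0]
  have hadj (i j : Fin m) : Integrable (fun x => c * (gram φ w x).adjugate i j) P :=
    (integrable_adjugate_gram hm hint i j).const_mul c
  have hadj_int (i j : Fin m) : ∫ x, c * (gram φ w x).adjugate i j ∂P =
      κ * (1 : Matrix (Fin m) (Fin m) ℝ) i j := by
    rw [integral_const_mul, integral_adjugate_gram hm hint hmom, ← mul_assoc,
      volumeSampling_const_mul hm hmn]
  have hsing : MeasurableSet {x : Fin n → 𝓧 | (gram φ w x).det = 0} :=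
    measurable_det_gram hφ hw (measurableSet_singleton 0)
  have hweight (i j : Fin m) (x : Fin n → 𝓧) :
      (ENNReal.ofReal (c * (gram φ w x).det)).toReal • (gram φ w x)⁻¹ i j =
        {x : Fin n → 𝓧 | (gram φ w x).det = 0}ᶜ.indicator
          (fun x => c * (gram φ w x).adjugate i j) x := by
    rw [ENNReal.toReal_ofReal (mul_nonneg hc0 (hpsd x).det_nonneg), smul_eq_mul, mul_assoc,
      det_mul_inv_apply]
    by_cases h : (gram φ w x).det = 0 <;> simp [h]
  have hinv_int (i j : Fin m) : Integrable (fun x => (gram φ w x)⁻¹ i j) (vs μ φ w n) := by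
    rw [vs, integrable_withDensity_iff_integrable_smul' hdens hdens_top]
    simp_rw [hweight]
    exact (hadj i j).indicator hsing.compl
  have hinv_eq (i j : Fin m) : ∫ x, (gram φ w x)⁻¹ i j ∂(vs μ φ w n) =
      ∫ x, {x : Fin n → 𝓧 | (gram φ w x).det = 0}ᶜ.indicator
        (fun x => c * (gram φ w x).adjugate i j) x ∂P := by
    rw [vs, integral_withDensity_eq_integral_toReal_smul hdens hdens_top]
    simp_rw [hweight]
  have hloewner : (κ • (1 : Matrix (Fin m) (Fin m) ℝ) -
      Matrix.of (fun i j => ∫ x, (gram φ w x)⁻¹ i j ∂(vs μ φ w n))).PosSemidef := by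
    have h := posSemidef_integral (P := P) (M := {x : Fin n → 𝓧 | (gram φ w x).det = 0}.indicator
      fun x => c • (gram φ w x).adjugate) (fun x => ?_) fun i j => ?_
    · convert h using 1
      ext i j
      rw [Matrix.sub_apply, Matrix.smul_apply, of_apply, of_apply, smul_eq_mul, hinv_eq,
        ← hadj_int, ← integral_sub (hadj i j) ((hadj i j).indicator hsing.compl)]
      congr with x
      by_cases h : (gram φ w x).det = 0 <;> simp [h]
    · by_cases h : (gram φ w x).det = 0
      · simpa [h] using (hpsd x).adjugate.smul hc0
      · simpa [h] using PosSemidef.zero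
    · refine ((hadj i j).indicator hsing).congr (ae_of_all _ fun x => ?_)
      by_cases h : (gram φ w x).det = 0 <;> simp [h]
  refine ⟨hinv, hloewner, fun hrank => ?_, ?_⟩
  · ext i j
    rw [Matrix.smul_apply, of_apply, smul_eq_mul, hinv_eq, ← hadj_int]
    refine integral_congr_ae ?_
    filter_upwards [hrank] with x hx
    simp [det_gram_ne_zero_of_rank φ hwpos hn hx]
  · calc ∫ x, (lambdaMin (gram φ w x))⁻¹ ∂(vs μ φ w n)
        ≤ ∫ x, (gram φ w x)⁻¹.trace ∂(vs μ φ w n) := by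
          refine integral_mono_of_nonneg
            (ae_of_all _ fun x => inv_nonneg.2 (lambdaMin_nonneg (hpsd x)))
            (integrable_finsetSum _ fun i _ => hinv_int i i) ?_
          filter_upwards [hinv] with x hx
          exact lambdaMin_inv_le_trace_inv hm (hpsd x) hx.ne_zero
      _ = ∑ i, ∫ x, (gram φ w x)⁻¹ i i ∂(vs μ φ w n) :=
          integral_finsetSum _ fun i _ => hinv_int i i
      _ ≤ ∑ _i : Fin m, κ := Finset.sum_le_sum fun i _ => by
          simpa using hloewner.diag_nonneg (i := i)
      _ = (n : ℝ) * m / ((n : ℝ) - m + 1) := by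
          rw [Finset.sum_const, Finset.card_univ, Fintype.card_fin, nsmul_eq_mul, hκ]
          ring
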